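/- arXiv:math/0612216 — 2 statements merged into one kernel-verified Lean document; each statement's English description precedes it below -/
import Mathlib

section
/- Let 0 < a < 1 and γ > 0, and for each positive integer n set q_n := exp(−2π γ^{-1} n^{−a}). Then there exist a constant C > 0 and a threshold N such that for all n ≥ N, | (q_n; q_n)_∞ / ( √(γ n^a) · exp( π n^{−a}/(12γ) − π γ n^a / 12 ) ) − 1 | ≤ C exp(−2π γ n^a), where (q_n;q_n)_∞ = ∏_{k=1}^∞ (1 − q_n^k). -/
open scoped BigOperators

/-- Euler's product. -/
noncomputable def eulerF (q : ℂ) : ℂ := ∏' k : ℕ, (1 - q ^ (k + 1))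

lemma ofReal_tprod_euler (q : ℝ) (h0 : 0 ≤ q) (h1 : q < 1) :
    ((∏' k : ℕ, (1 - q ^ (k + 1)) : ℝ) : ℂ) = eulerF (q : ℂ) := by
  have hm : Multipliable fun k : ℕ => 1 - q ^ (k + 1) := by
    simp only [sub_eq_add_neg]
    apply multipliable_one_add_of_summable (f := fun n ↦ -q ^ (n + 1))
    simpa [abs_of_nonneg h0] using (summable_nat_add_iff 1).mpr (summable_geometric_of_lt_one h0 h1)
  have := hm.map_tprod Complex.ofRealHom Complex.continuous_ofReal
  simpa [eulerF] using this

lemma csqrt_eq_exp {z : ℂ} (hz : z ≠ 0) : Complex.sqrt z = Complex.exp (Complex.log z / 2) := by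
  rw [Complex.sqrt, Complex.cpow_def_of_ne_zero hz]
  congr 1

lemma csqrt_mul_I (t : ℝ) (ht : 0 < t) :
    Complex.sqrt (t * Complex.I) = (Real.sqrt t : ℂ) * Complex.sqrt Complex.I := by
  have ht' : (t : ℂ) ≠ 0 := by exact_mod_cast ht.ne'
  rw [csqrt_eq_exp (mul_ne_zero ht' Complex.I_ne_zero),
    csqrt_eq_exp Complex.I_ne_zero, Complex.log_ofReal_mul ht Complex.I_ne_zero,
    Real.sqrt_eq_rpow, Real.rpow_def_of_pos ht, Complex.ofReal_exp, ← Complex.exp_add]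
  congr 1
  push_cast
  ring

lemma eta_eq (t : ℝ) : ModularForm.eta (t * Complex.I) =
    (Real.exp (- Real.pi * t / 12) : ℂ) * eulerF (Real.exp (-2 * Real.pi * t) : ℝ) := by
  have h : ∀ x c : ℂ, 2 * x * Complex.I * (t * Complex.I) / c = - (2 * x * t) / c := by
    intro x c
    linear_combination (2 * x * t / c) * Complex.I_sq
  unfold ModularForm.eta eulerF ModularForm.eta_q Function.Periodic.qParam
  rw [Complex.ofReal_exp, Complex.ofReal_exp, h, h]
  congr 2
  · push_cast; ring
  · push_cast; ring_nf

lemma euler_transform (t : ℝ) (ht : 0 < t) :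
    eulerF (Real.exp (-2 * Real.pi * t⁻¹) : ℝ) =
      (Real.sqrt t * Real.exp (Real.pi / (12 * t) - Real.pi * t / 12) : ℝ) *
        eulerF (Real.exp (-2 * Real.pi * t) : ℝ) := by
  have hz : (t * Complex.I) ∈ UpperHalfPlane.upperHalfPlaneSet := by
    simpa [UpperHalfPlane.upperHalfPlaneSet] using ht
  have ht' : (t : ℂ) ≠ 0 := by exact_mod_cast ht.ne'
  have h := ModularForm.eta_comp_eq_csqrt_I_inv hz
  have hs : Complex.sqrt Complex.I ≠ 0 := by
    rw [csqrt_eq_exp Complex.I_ne_zero]; exact Complex.exp_ne_zero _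
  have hi : (-1 / (t * Complex.I) : ℂ) = (t⁻¹ : ℝ) * Complex.I := by
    push_cast
    field_simp
    simp
  simp only [Function.comp_apply, Pi.smul_apply, Pi.mul_apply, smul_eq_mul] at h
  rw [hi, eta_eq, eta_eq, csqrt_mul_I t ht] at h
  have h2 : (Real.sqrt t * Real.exp (Real.pi / (12 * t) - Real.pi * t / 12) : ℝ) =
      Real.sqrt t * Real.exp (-Real.pi * t / 12) / Real.exp (-Real.pi * t⁻¹ / 12) := by
    rw [mul_div_assoc (Real.sqrt t), ← Real.exp_sub]
    congr 2
    field_simp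
    ring
  rw [h2]
  have he : (Real.exp (-Real.pi * t⁻¹ / 12) : ℂ) ≠ 0 := by
    exact_mod_cast (Real.exp_pos _).ne'
  apply mul_left_cancel₀ he
  rw [h]
  push_cast at he ⊢
  field_simp

lemma euler_bound : (fun q : ℂ => eulerF q - 1) =O[nhds 0] fun q => q := by
  have h : DifferentiableAt ℂ eulerF 0 :=
    ModularForm.differentiableOn_tprod_one_sub_pow.differentiableAt
      (Metric.ball_mem_nhds 0 one_pos)
  have := h.isBigO_sub
  simpa [eulerF] using this

/-- Let `0 < a < 1` and `γ > 0`, and for each positive integer `n` set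
`q_n := exp(-2π γ⁻¹ n^{-a})`. Then there exist `C > 0` and a threshold `N` such that for all
`n ≥ N`,
`|(q_n;q_n)_∞ / (√(γ n^a) · exp(π n^{-a}/(12γ) - π γ n^a/12)) - 1| ≤ C exp(-2πγ n^a)`. -/
theorem stmt9 (a γ : ℝ) (ha0 : 0 < a) (ha1 : a < 1) (hγ : 0 < γ) :
    ∃ C : ℝ, 0 < C ∧ ∃ N : ℕ, ∀ n : ℕ, N ≤ n →
      |(∏' k : ℕ, (1 - Real.exp (-2 * Real.pi / γ * (n : ℝ) ^ (-a)) ^ (k + 1))) /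
          (Real.sqrt (γ * (n : ℝ) ^ a) *
            Real.exp (Real.pi * (n : ℝ) ^ (-a) / (12 * γ) -
              Real.pi * γ * (n : ℝ) ^ a / 12)) - 1| ≤
        C * Real.exp (-2 * Real.pi * γ * (n : ℝ) ^ a) := by
  obtain ⟨C, hC, hb⟩ := euler_bound.exists_pos
  have hlim : Filter.Tendsto (fun n : ℕ =>
      ((Real.exp (-2 * Real.pi * γ * (n : ℝ) ^ a) : ℝ) : ℂ)) Filter.atTop (nhds 0) := by
    rw [← Complex.ofReal_zero]
    refine (Complex.continuous_ofReal.tendsto _).comp ?_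
    refine Real.tendsto_exp_atBot.comp ?_
    refine Filter.Tendsto.const_mul_atTop_of_neg ?_
      ((tendsto_rpow_atTop ha0).comp tendsto_natCast_atTop_atTop)
    have := mul_pos Real.pi_pos hγ
    nlinarith
  have hev := (hlim.eventually hb.bound).and (Filter.eventually_ge_atTop 1)
  obtain ⟨N, hN⟩ := Filter.eventually_atTop.mp hev
  refine ⟨C, hC, N, fun n hn => ?_⟩
  obtain ⟨h1, h2⟩ := hN n hn
  have hn0 : (0 : ℝ) < n := by exact_mod_cast h2
  have hna : 0 < (n : ℝ) ^ a := Real.rpow_pos_of_pos hn0 a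
  set t : ℝ := γ * (n : ℝ) ^ a with ht
  have htp : 0 < t := mul_pos hγ hna
  have e1 : -2 * Real.pi / γ * (n : ℝ) ^ (-a) = -2 * Real.pi * t⁻¹ := by
    rw [Real.rpow_neg hn0.le, ht]; field_simp
  have e2 : Real.pi * (n : ℝ) ^ (-a) / (12 * γ) - Real.pi * γ * (n : ℝ) ^ a / 12
      = Real.pi / (12 * t) - Real.pi * t / 12 := by
    rw [Real.rpow_neg hn0.le, ht]; field_simp
  have e3 : -2 * Real.pi * γ * (n : ℝ) ^ a = -2 * Real.pi * t := by rw [ht]; ring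
  rw [e3] at h1 ⊢
  rw [e1, e2]
  have hq : Real.exp (-2 * Real.pi * t⁻¹) < 1 := by
    rw [Real.exp_lt_one_iff]
    have := mul_pos Real.pi_pos (inv_pos.mpr htp)
    nlinarith
  set D := Real.sqrt t * Real.exp (Real.pi / (12 * t) - Real.pi * t / 12) with hD
  have hDp : 0 < D := mul_pos (Real.sqrt_pos.mpr htp) (Real.exp_pos _)
  have hDc : (D : ℂ) ≠ 0 := by exact_mod_cast hDp.ne'
  rw [← Real.norm_eq_abs, ← Complex.norm_real, Complex.ofReal_sub, Complex.ofReal_div,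
    ofReal_tprod_euler _ (Real.exp_pos _).le hq, euler_transform t htp, ← hD,
    mul_div_cancel_left₀ _ hDc, Complex.ofReal_one]
  refine h1.trans_eq ?_
  rw [Complex.norm_real, Real.norm_of_nonneg (Real.exp_pos _).le]
end

section
/- Let γ > 0, and for each integer n ≥ 2 set q_n := exp(−2π/(γ log n)). Then there exist a constant C > 0 and a threshold N such that for all n ≥ N, | (q_n; q_n)_∞ / ( n^{−πγ/12} · √(γ log n) · exp( π/(12 γ log n) ) ) − 1 | ≤ C n^{−2πγ}, where (q_n;q_n)_∞ = ∏_{k=1}^∞ (1 − q_n^k). -/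
open scoped BigOperators

lemma multR {r : ℝ} (h0 : 0 ≤ r) (h1 : r < 1) : Multipliable fun k : ℕ ↦ 1 - r ^ (k + 1) := by
  apply multipliable_one_add_of_summable (f := fun n : ℕ ↦ -r ^ (n + 1))
  have := (summable_nat_add_iff 1).mpr (summable_geometric_of_lt_one h0 h1)
  simpa [abs_of_nonneg h0] using this

lemma tprod_near_one {x : ℝ} (h0 : 0 ≤ x) (h1 : x ≤ 1 / 2) :
    |(∏' k : ℕ, (1 - x ^ (k + 1))) - 1| ≤ 2 * x := by
  have key : ∀ m : ℕ, 1 - 2 * x + 2 * x * (1 / 2) ^ m ≤ ∏ k ∈ Finset.range m, (1 - x ^ (k + 1)) ∧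
      ∏ k ∈ Finset.range m, (1 - x ^ (k + 1)) ≤ 1 := by
    intro m
    induction m with
    | zero => simp
    | succ m ih =>
      obtain ⟨a, b⟩ := ih
      rw [Finset.prod_range_succ]
      set p := ∏ k ∈ Finset.range m, (1 - x ^ (k + 1))
      have hy0 : 0 ≤ x ^ (m + 1) := by positivity
      have hy1 : x ^ (m + 1) ≤ x * (1 / 2) ^ m := by
        rw [pow_succ']
        gcongr
      have hp0 : 0 ≤ p := by
        have : 0 ≤ 2 * x * (1 / 2) ^ m := by positivity
        linarith
      have e : 2 * x * (1 / 2 : ℝ) ^ (m + 1) = x * (1 / 2) ^ m := by ring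
      constructor
      · rw [e]; nlinarith
      · nlinarith
  have hT := (multR h0 (by linarith)).hasProd.tendsto_prod_nat
  have l1 := ge_of_tendsto' hT (fun m ↦ (le_trans (by
    have : 0 ≤ 2 * x * (1 / 2) ^ m := by positivity
    linarith) (key m).1 : 1 - 2 * x ≤ _))
  have l2 := le_of_tendsto' hT (fun m ↦ (key m).2)
  rw [abs_le]
  constructor <;> linarith

lemma norm_eta_I {t : ℝ} (ht : 0 < t) : ‖ModularForm.eta (Complex.I * t)‖ =
    Real.exp (-(Real.pi * t) / 12) * ∏' k : ℕ, (1 - Real.exp (-2 * Real.pi * t) ^ (k + 1)) := by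
  have hlt : Real.exp (-2 * Real.pi * t) < 1 := by
    rw [Real.exp_lt_one_iff]
    have := mul_pos Real.pi_pos ht
    linarith
  have hm := multR (Real.exp_pos _).le hlt
  have h1 : ∏' n, (1 - ModularForm.eta_q n (Complex.I * t)) =
      ((∏' k : ℕ, (1 - Real.exp (-2 * Real.pi * t) ^ (k + 1)) : ℝ) : ℂ) := by
    have := hm.map_tprod Complex.ofRealHom Complex.continuous_ofReal
    simp only [Complex.ofRealHom_eq_coe] at this
    rw [this]
    congr 1
    ext k
    rw [ModularForm.eta_q_eq_pow]
    push_cast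
    congr 3
    linear_combination (2 * Real.pi * t) * Complex.I_mul_I
  have hnn : 0 ≤ ∏' k : ℕ, (1 - Real.exp (-2 * Real.pi * t) ^ (k + 1)) := by
    refine ge_of_tendsto' hm.hasProd.tendsto_prod_nat (fun m ↦ Finset.prod_nonneg fun k _ ↦ ?_)
    have := pow_le_one₀ (n := k + 1) (Real.exp_pos (-2 * Real.pi * t)).le hlt.le
    linarith
  rw [ModularForm.eta, norm_mul, h1, Complex.norm_real, Real.norm_of_nonneg hnn,
    Function.Periodic.norm_qParam]
  congr 2
  simp
  ring

lemma eta_trans {t : ℝ} (ht : 0 < t) : ‖ModularForm.eta (Complex.I * (t⁻¹ : ℝ))‖ =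
    Real.sqrt t * ‖ModularForm.eta (Complex.I * t)‖ := by
  have h := ModularForm.eta_comp_eq_csqrt_I_inv
    (show Complex.I * t ∈ UpperHalfPlane.upperHalfPlaneSet by
      simpa [UpperHalfPlane.upperHalfPlaneSet] using ht)
  have e : -1 / (Complex.I * t) = Complex.I * (t⁻¹ : ℝ) := by
    have : (t : ℂ) ≠ 0 := by exact_mod_cast ht.ne'
    push_cast
    field_simp
    simp
  simp only [Function.comp, e] at h
  rw [h]
  have hs : ∀ z : ℂ, ‖Complex.sqrt z‖ = Real.sqrt ‖z‖ := by
    intro z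
    rw [Complex.sqrt, Real.sqrt_eq_rpow, ← Complex.norm_cpow_real]
    norm_num
  simp [hs, abs_of_pos ht]

theorem main_id {t : ℝ} (ht : 0 < t) :
    ∏' k : ℕ, (1 - Real.exp (-2 * Real.pi / t) ^ (k + 1)) =
    Real.exp (-(Real.pi * t) / 12) * Real.sqrt t * Real.exp (Real.pi / (12 * t)) *
      ∏' k : ℕ, (1 - Real.exp (-2 * Real.pi * t) ^ (k + 1)) := by
  have h := eta_trans ht
  rw [norm_eta_I ht, norm_eta_I (inv_pos.2 ht)] at h
  have e : Real.exp (Real.pi / (12 * t)) * Real.exp (-(Real.pi * t⁻¹) / 12) = 1 := by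
    rw [← Real.exp_add, Real.exp_eq_one_iff]
    field_simp
    ring
  rw [div_eq_mul_inv (-2 * Real.pi) t]
  linear_combination Real.exp (Real.pi / (12 * t)) * h -
    (∏' k : ℕ, (1 - Real.exp (-2 * Real.pi * t⁻¹) ^ (k + 1))) * e

/-- Let `γ > 0`, and for each integer `n ≥ 2` set `q_n := exp(-2π/(γ log n))`.
Then there exist `C > 0` and a threshold `N` such that for all `n ≥ N`,
`|(q_n;q_n)_∞ / (n^{-πγ/12} · √(γ log n) · exp(π/(12 γ log n))) - 1| ≤ C n^{-2πγ}`. -/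
theorem stmt10 (γ : ℝ) (hγ : 0 < γ) :
    ∃ C : ℝ, 0 < C ∧ ∃ N : ℕ, 2 ≤ N ∧ ∀ n : ℕ, N ≤ n →
      |(∏' k : ℕ, (1 - Real.exp (-2 * Real.pi / (γ * Real.log n)) ^ (k + 1))) /
          ((n : ℝ) ^ (-(Real.pi * γ) / 12) * Real.sqrt (γ * Real.log n) *
            Real.exp (Real.pi / (12 * γ * Real.log n))) - 1| ≤
        C * (n : ℝ) ^ (-(2 * Real.pi * γ)) := by
  have hlim : Filter.Tendsto (fun n : ℕ ↦ (n : ℝ) ^ (-(2 * Real.pi * γ))) Filter.atTop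
      (nhds 0) :=
    (tendsto_rpow_neg_atTop (by positivity)).comp tendsto_natCast_atTop_atTop
  obtain ⟨N, hN⟩ := Filter.eventually_atTop.1
    (hlim.eventually_le_const (show (0 : ℝ) < 1 / 2 by norm_num))
  refine ⟨2, by norm_num, max N 2, le_max_right _ _, fun n hn ↦ ?_⟩
  have hn2 : 2 ≤ n := (le_max_right _ _).trans hn
  have hx := hN n ((le_max_left _ _).trans hn)
  have hn0 : (0 : ℝ) < n := by positivity
  have hlog : 0 < Real.log n := Real.log_pos (by exact_mod_cast hn2)
  have ht : 0 < γ * Real.log n := mul_pos hγ hlog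
  have e1 : (n : ℝ) ^ (-(Real.pi * γ) / 12) =
      Real.exp (-(Real.pi * (γ * Real.log n)) / 12) := by
    rw [Real.rpow_def_of_pos hn0]
    ring_nf
  have e2 : (n : ℝ) ^ (-(2 * Real.pi * γ)) = Real.exp (-2 * Real.pi * (γ * Real.log n)) := by
    rw [Real.rpow_def_of_pos hn0]
    ring_nf
  rw [e2] at hx ⊢
  rw [main_id ht, e1, mul_assoc 12 γ, mul_div_cancel_left₀]
  · exact tprod_near_one (Real.exp_pos _).le hx
  · have := Real.sqrt_pos.2 ht
    positivity
end
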